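/- arXiv:0907.2775 — 4 statements merged into one kernel-verified Lean document; each statement's English description precedes it below -/
import Mathlib

section
/- (Satisfiability for T_spec) Let r1, r2, r4 be binary relations on a set EO such that: (1) r1 is irreflexive and transitive; (2) r2 is irreflexive and weakly transitive (r2 a b ∧ r2 b c ∧ a ≠ c → r2 a c), r2 = r1 ∪ r3 where r3 ⊆ incomparability(r1), and there is no triangle of either forbidden form, i.e., for no u, v, w do we have (r1 u v ∧ r3 v w ∧ r3 u w) or (r3 u v ∧ r1 v w ∧ r3 u w); (3) r4 = comparability(r1) ∪ r5 where r5 is symmetric and r5 ⊆ incomparability(r2). Then (≺, ⊏, <>) := (r1, r2, r4) is a gso-structure on EO: r4 is irreflexive and symmetric; r1 a b holds iff r2 a b ∧ r4 a b; r2 is irreflexive and weakly transitive; and the mixed transitivity law holds ((r2 a b ∧ r1 b c) ∨ (r1 a b ∧ r2 b c) → r1 a c). -/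
/-- The incomparability ("frown") relation of a binary relation `r`. -/
def frownRel {X : Type*} (r : X → X → Prop) (a b : X) : Prop :=
  a ≠ b ∧ ¬ r a b ∧ ¬ r b a

/-- `sym(r) = r ∪ r⁻¹`. -/
def symRel {X : Type*} (r : X → X → Prop) (a b : X) : Prop :=
  r a b ∨ r b a

/-- `r^frown = {(x,y) : x ≠ y ∧ ¬ r y x}`. -/
def frownExt {X : Type*} (r : X → X → Prop) (a b : X) : Prop :=
  a ≠ b ∧ ¬ r b a

/-- A stratified order. -/
structure IsStratified {X : Type*} (r : X → X → Prop) : Prop where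
  irrefl : ∀ a, ¬ r a a
  trans : ∀ a b c, r a b → r b c → r a c
  frown_trans : ∀ a b c, frownRel r a b → frownRel r b c → frownRel r a c ∨ a = c

/-- A gso-structure `(≺, ⊏, <>) = (pre, nlt, ns)` on a type `X`. -/
structure IsGso {X : Type*} (pre nlt ns : X → X → Prop) : Prop where
  ns_irrefl : ∀ a, ¬ ns a a
  ns_symm : ∀ a b, ns a b → ns b a
  pre_iff : ∀ a b, pre a b ↔ nlt a b ∧ ns a b
  nlt_irrefl : ∀ a, ¬ nlt a a
  nlt_wtrans : ∀ a b c, nlt a b → nlt b c → a ≠ c → nlt a c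
  mixed : ∀ a b c, (nlt a b ∧ pre b c) ∨ (pre a b ∧ nlt b c) → pre a c

/-- A stratified order `r` is a stratified extension of a gso-structure `(pre, nlt, ns)`. -/
def IsStratExt {X : Type*} (pre nlt ns r : X → X → Prop) : Prop :=
  IsStratified r ∧ (∀ a b, ns a b → symRel r a b) ∧ (∀ a b, nlt a b → frownExt r a b)

/-- (Satisfiability theorem for the specification theory) The graph-theoretic
decomposition conditions yield a gso-structure `(r1, r2, r4)`. -/
theorem satisfiability_spec {X : Type*} (r1 r2 r3 r4 r5 : X → X → Prop)
    (h1irr : ∀ a, ¬ r1 a a) (h1tr : ∀ a b c, r1 a b → r1 b c → r1 a c)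
    (h2irr : ∀ a, ¬ r2 a a)
    (h2wtr : ∀ a b c, r2 a b → r2 b c → a ≠ c → r2 a c)
    (h2 : ∀ a b, r2 a b ↔ r1 a b ∨ r3 a b)
    (h3 : ∀ a b, r3 a b → frownRel r1 a b)
    (htri1 : ∀ u v w, ¬ (r1 u v ∧ r3 v w ∧ r3 u w))
    (htri2 : ∀ u v w, ¬ (r3 u v ∧ r1 v w ∧ r3 u w))
    (h4 : ∀ a b, r4 a b ↔ symRel r1 a b ∨ r5 a b)
    (h5symm : ∀ a b, r5 a b → r5 b a)
    (h5 : ∀ a b, r5 a b → frownRel r2 a b) :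
    IsGso r1 r2 r4 := by
  have h12 : ∀ a b, r1 a b → r2 a b := fun a b h => (h2 a b).2 (.inl h)
  refine ⟨?_, ?_, ?_, h2irr, h2wtr, ?_⟩
  · intro a h
    rcases (h4 a a).1 h with (h | h) | h
    · exact h1irr a h
    · exact h1irr a h
    · exact (h5 a a h).1 rfl
  · intro a b h
    exact (h4 b a).2 (((h4 a b).1 h).imp Or.symm (h5symm a b))
  · refine fun a b => ⟨fun h => ⟨h12 a b h, (h4 a b).2 (.inl (.inl h))⟩, ?_⟩
    rintro ⟨hab, h⟩
    rcases (h4 a b).1 h with (h | h) | h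
    · exact h
    · exact ((h2 a b).1 hab).resolve_right fun h' => (h3 a b h').2.2 h
    · exact absurd hab (h5 a b h).2.1
  · rintro a b c (⟨hab, hbc⟩ | ⟨hab, hbc⟩)
    · rcases (h2 a b).1 hab with h | h
      · exact h1tr a b c h hbc
      · have hac : a ≠ c := by
          rintro rfl
          exact (h3 a b h).2.2 hbc
        exact ((h2 a c).1 (h2wtr a b c hab (h12 b c hbc) hac)).resolve_right
          fun h' => htri2 a b c ⟨h, hbc, h'⟩
    · rcases (h2 b c).1 hbc with h | h
      · exact h1tr a b c hab h
      · have hac : a ≠ c := by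
          rintro rfl
          exact (h3 b a h).2.2 hab
        exact ((h2 a c).1 (h2wtr a b c (h12 a b hab) hbc hac)).resolve_right
          fun h' => htri1 a b c ⟨hab, h, h'⟩
end

section
/- (Axiomatizability for T_spec) Let (≺, ⊏, <>) be a gso-structure on a set EO. Define r3 a b := ⊏ a b ∧ ¬ ≺ a b and r5 a b := <> a b ∧ ¬ ≺ a b ∧ ¬ ≺ b a. Then: (1) ≺ is irreflexive and transitive; (2) ⊏ = ≺ ∪ r3, r3 ⊆ incomparability(≺), and there is no triangle of either forbidden form, i.e., for no u, v, w do we have (≺ u v ∧ r3 v w ∧ r3 u w) or (r3 u v ∧ ≺ v w ∧ r3 u w); (3) <> = comparability(≺) ∪ r5, r5 is symmetric, and r5 ⊆ incomparability(⊏). -/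
/-- (Axiomatizability theorem for the specification theory) Every gso-structure
satisfies the graph-theoretic decomposition conditions. -/
theorem axiomatizability_spec {X : Type*} (pre nlt ns r3 r5 : X → X → Prop)
    (hgso : IsGso pre nlt ns)
    (hr3 : ∀ a b, r3 a b ↔ nlt a b ∧ ¬ pre a b)
    (hr5 : ∀ a b, r5 a b ↔ ns a b ∧ ¬ pre a b ∧ ¬ pre b a) :
    ((∀ a, ¬ pre a a) ∧ (∀ a b c, pre a b → pre b c → pre a c)) ∧
    ((∀ a b, nlt a b ↔ pre a b ∨ r3 a b) ∧
      (∀ a b, r3 a b → frownRel pre a b) ∧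
      (∀ u v w, ¬ (pre u v ∧ r3 v w ∧ r3 u w)) ∧
      (∀ u v w, ¬ (r3 u v ∧ pre v w ∧ r3 u w))) ∧
    ((∀ a b, ns a b ↔ symRel pre a b ∨ r5 a b) ∧
      (∀ a b, r5 a b → r5 b a) ∧
      (∀ a b, r5 a b → frownRel nlt a b)) := by
  obtain ⟨ns_irrefl, ns_symm, pre_iff, nlt_irrefl, -, mixed⟩ := hgso
  have pre_irrefl : ∀ a, ¬ pre a a := fun a h => nlt_irrefl a ((pre_iff a a).1 h).1
  have pre_nlt : ∀ {a b}, pre a b → nlt a b := fun h => ((pre_iff _ _).1 h).1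
  have pre_ns : ∀ {a b}, pre a b → ns a b := fun h => ((pre_iff _ _).1 h).2
  refine ⟨⟨pre_irrefl, fun a b c hab hbc => mixed a b c (.inl ⟨pre_nlt hab, hbc⟩)⟩,
    ⟨fun a b => ?_, fun a b h => ?_, ?_, ?_⟩, fun a b => ?_, fun a b h => ?_, fun a b h => ?_⟩
  · rw [hr3]
    have := @pre_nlt a b
    tauto
  · obtain ⟨hn, hp⟩ := (hr3 a b).1 h
    refine ⟨?_, hp, fun hba => pre_irrefl a (mixed a b a (.inl ⟨hn, hba⟩))⟩
    rintro rfl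
    exact nlt_irrefl a hn
  · rintro u v w ⟨huv, hvw, huw⟩
    exact ((hr3 u w).1 huw).2 (mixed u v w (.inr ⟨huv, ((hr3 v w).1 hvw).1⟩))
  · rintro u v w ⟨huv, hvw, huw⟩
    exact ((hr3 u w).1 huw).2 (mixed u v w (.inl ⟨((hr3 u v).1 huv).1, hvw⟩))
  · rw [hr5, symRel]
    have hab := @pre_ns a b
    have hba : pre b a → ns a b := fun h => ns_symm b a (pre_ns h)
    tauto
  · obtain ⟨hn, hab, hba⟩ := (hr5 a b).1 h
    exact (hr5 b a).2 ⟨ns_symm a b hn, hba, hab⟩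
  · obtain ⟨hn, hab, hba⟩ := (hr5 a b).1 h
    refine ⟨?_, fun hl => hab ((pre_iff a b).2 ⟨hl, hn⟩),
      fun hl => hba ((pre_iff b a).2 ⟨hl, ns_symm a b hn⟩)⟩
    rintro rfl
    exact ns_irrefl a hn
end

section
/- (Consistency of the gso-structure theory) There exist a finite set X, a gso-structure (≺, ⊏, <>) on X, and a nonempty finite family (⊲_o)_{o ∈ O} of stratified orders on X satisfying observation soundness (<> ⊆ sym(⊲_o) and ⊏ ⊆ ⊲_o^frown for every o) and observation completeness (for all a ≠ b: if ¬ <> a b then some ⊲_o makes a and b incomparable, and if ¬ ⊏ a b then b ⊲_o a for some o), such that moreover the gso-structure is nontrivial: there exist a, b with ⊏ a b ∧ ¬ ≺ a b, and there exist a, b with <> a b ∧ ¬ ⊏ a b ∧ ¬ ⊏ b a. -/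
/-- The relation obtained by comparing ranks is a stratified order. -/
theorem isStratified_of_rank {X : Type*} (rank : X → ℕ) :
    IsStratified fun a b => rank a < rank b where
  irrefl _ := lt_irrefl _
  trans _ _ _ := lt_trans
  frown_trans a b c := by
    rintro ⟨_, hab, hba⟩ ⟨_, hbc, hcb⟩
    by_cases hac : a = c
    · exact Or.inr hac
    · exact Or.inl ⟨hac, by omega, by omega⟩

/-- (Consistency) There is a finite nontrivial gso-structure together with a
nonempty finite family of stratified orders satisfying observation soundness
and observation completeness. -/
theorem gso_theory_consistent :
    ∃ (n m : ℕ) (pre nlt ns : Fin n → Fin n → Prop)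
      (f : Fin m → Fin n → Fin n → Prop),
      0 < m ∧
      IsGso pre nlt ns ∧
      (∀ o, IsStratified (f o)) ∧
      (∀ o, (∀ a b, ns a b → symRel (f o) a b) ∧
        (∀ a b, nlt a b → frownExt (f o) a b)) ∧
      (∀ a b, a ≠ b →
        ((¬ ns a b → ∃ o, ¬ f o a b ∧ ¬ f o b a) ∧
         (¬ nlt a b → ∃ o, f o b a))) ∧
      (∃ a b, nlt a b ∧ ¬ pre a b) ∧
      (∃ a b, ns a b ∧ ¬ nlt a b ∧ ¬ nlt b a) := by
  let rank : Fin 3 → Fin 3 → ℕ := ![![0, 0, 1], ![0, 1, 0], ![1, 1, 0]]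
  refine ⟨3, 3, fun _ _ => False, fun a b => a = 0 ∧ b = 1,
    fun a b => (a = 1 ∧ b = 2) ∨ (a = 2 ∧ b = 1),
    fun o a b => rank o a < rank o b, by decide, ?_,
    fun o => isStratified_of_rank (rank o), ?_, by decide, by decide, by decide⟩
  · constructor <;> decide
  · unfold symRel frownExt
    decide
end

section
/- Every stratified order induces a gso-structure: if ⊲ is a stratified order on a set X, then the triple (≺, ⊏, <>) := (⊲, ⊲^frown, sym(⊲)) is a gso-structure on X; that is, sym(⊲) is irreflexive and symmetric; ⊲ a b holds iff ⊲^frown a b and sym(⊲) a b; ⊲^frown is irreflexive and weakly transitive (⊲^frown a b ∧ ⊲^frown b c ∧ a ≠ c → ⊲^frown a c); and mixed transitivity holds ((⊲^frown a b ∧ ⊲ b c) ∨ (⊲ a b ∧ ⊲^frown b c) → ⊲ a c). -/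
/-- A stratified order is negatively transitive (stated contrapositively). -/
theorem IsStratified.rel_or_rel {X : Type*} {r : X → X → Prop} (h : IsStratified r)
    {a c : X} (hac : r a c) (b : X) : r a b ∨ r b c := by
  by_contra! hn
  obtain ⟨hab, hbc⟩ := hn
  have f₁ : frownRel r a b :=
    ⟨fun e => hbc (e ▸ hac), hab, fun hba => hbc (h.trans _ _ _ hba hac)⟩
  have f₂ : frownRel r b c :=
    ⟨fun e => hab (e ▸ hac), hbc, fun hcb => hab (h.trans _ _ _ hac hcb)⟩
  rcases h.frown_trans _ _ _ f₁ f₂ with f | rfl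
  · exact f.2.1 hac
  · exact h.irrefl _ hac

/-- Every stratified order induces a gso-structure `(⊲, ⊲^frown, sym(⊲))`. -/
theorem stratified_induces_gso {X : Type*} (r : X → X → Prop)
    (h : IsStratified r) :
    IsGso r (frownExt r) (symRel r) := by
  have asymm : ∀ a b, r a b → ¬ r b a := fun a b hab hba =>
    h.irrefl a (h.trans _ _ _ hab hba)
  refine ⟨fun a ha => ha.elim (h.irrefl a) (h.irrefl a), fun a b => Or.symm,
    fun a b => ⟨fun hab => ⟨⟨?_, asymm _ _ hab⟩, Or.inl hab⟩,
      fun hab => hab.2.resolve_right hab.1.2⟩,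
    fun a ha => ha.1 rfl, fun a b c hab hbc hac => ⟨hac, fun hca => ?_⟩, ?_⟩
  · rintro rfl
    exact h.irrefl _ hab
  · exact (h.rel_or_rel hca b).elim hbc.2 hab.2
  · rintro a b c (⟨hab, hbc⟩ | ⟨hab, hbc⟩)
    · exact (h.rel_or_rel hbc a).resolve_left hab.2
    · exact (h.rel_or_rel hab c).resolve_right hbc.2
end
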